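/- For every integer n ≥ 0, the element β_n⁻¹ γ_n of B_4 is a product of 2n+2 conjugates of Artin generators; that is, γ_n is obtained from β_n by multiplying on the right by 2n+2 elements of the form g σ_i g⁻¹ (g ∈ B_4, i ∈ {1,2,3}). In particular β_n⁻¹ γ_n is quasipositive. -/

import Mathlib

/-- The braid relations for the braid group `B₄` on generators `σ₁, σ₂, σ₃`
(indexed here by `0, 1, 2 : Fin 3`). -/
def braidRels4 : Set (FreeGroup (Fin 3)) :=
  {FreeGroup.of 0 * FreeGroup.of 1 * FreeGroup.of 0 *
      (FreeGroup.of 1 * FreeGroup.of 0 * FreeGroup.of 1)⁻¹,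
   FreeGroup.of 1 * FreeGroup.of 2 * FreeGroup.of 1 *
      (FreeGroup.of 2 * FreeGroup.of 1 * FreeGroup.of 2)⁻¹,
   FreeGroup.of 0 * FreeGroup.of 2 * (FreeGroup.of 2 * FreeGroup.of 0)⁻¹}

/-- The braid group `B₄` on four strands. -/
abbrev B4 := PresentedGroup braidRels4

/-- The Artin generator `σ_{i+1}` of `B₄` (0-indexed: `σ 0 = σ₁`, `σ 1 = σ₂`, `σ 2 = σ₃`). -/
def σ (i : Fin 3) : B4 := PresentedGroup.of i

/-- The band generator `σ_{1,3} = σ₁ σ₂ σ₁⁻¹`. -/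
def σ13 : B4 := σ 0 * σ 1 * (σ 0)⁻¹

/-- The band generator `σ_{2,4} = σ₂ σ₃ σ₂⁻¹`. -/
def σ24 : B4 := σ 1 * σ 2 * (σ 1)⁻¹

/-- The band generator `σ_{1,4} = (σ₁ σ₂) σ₃ (σ₁ σ₂)⁻¹`. -/
def σ14 : B4 := (σ 0 * σ 1) * σ 2 * (σ 0 * σ 1)⁻¹

/-- The braid `β_n = σ_{1,4} σ₂ (σ₁ⁿ σ_{1,3}⁻¹ σ₁⁻ⁿ) σ_{2,4} (σ₁ⁿ σ_{1,3} σ₁⁻ⁿ)`. -/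
def β (n : ℕ) : B4 :=
  σ14 * σ 1 * ((σ 0) ^ n * σ13⁻¹ * ((σ 0) ^ n)⁻¹) * σ24 * ((σ 0) ^ n * σ13 * ((σ 0) ^ n)⁻¹)

/-- The braid `γ_n = σ_{1,4} σ₂ σ_{2,4} σ₁ⁿ σ_{1,3} σ₂^{n+1}`. -/
def γ (n : ℕ) : B4 :=
  σ14 * σ 1 * σ24 * (σ 0) ^ n * σ13 * (σ 1) ^ (n + 1)

/-- The quasipositive submonoid of `B₄`: the submonoid generated by all conjugates
of the Artin generators. -/
def QP4 : Submonoid B4 :=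
  Submonoid.closure {x : B4 | ∃ (g : B4) (i : Fin 3), x = g * σ i * g⁻¹}

theorem beta_inv_gamma_eq (n : ℕ) (v : B4)
    (hv : v = σ24 * ((σ 0) ^ n * σ13 * ((σ 0) ^ n)⁻¹)) :
    (β n)⁻¹ * γ n =
      (v⁻¹ * (σ 0) ^ n * σ 0) * σ 1 * (v⁻¹ * (σ 0) ^ n * σ 0)⁻¹ *
        ((σ 0) ^ n * (σ 1) ^ (n + 1)) := by
  subst hv
  simp only [β, γ, σ13]
  group

theorem list_prod_mem_QP4 {l : List B4}
    (hl : ∀ x ∈ l, ∃ (g : B4) (i : Fin 3), x = g * σ i * g⁻¹) : l.prod ∈ QP4 :=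
  Submonoid.list_prod_mem _ fun x hx => Submonoid.subset_closure (hl x hx)

/-- For every `n ≥ 0`, the element `β_n⁻¹ γ_n` is a product of `2n+2` conjugates of Artin
generators; in particular it is quasipositive. -/
theorem beta_inv_gamma_quasipositive (n : ℕ) :
    (∃ l : List B4, l.length = 2 * n + 2 ∧
      (∀ x ∈ l, ∃ (g : B4) (i : Fin 3), x = g * σ i * g⁻¹) ∧
      (β n)⁻¹ * γ n = l.prod) ∧
    (β n)⁻¹ * γ n ∈ QP4 := by
  have key : ∃ l : List B4, l.length = 2 * n + 2 ∧
      (∀ x ∈ l, ∃ (g : B4) (i : Fin 3), x = g * σ i * g⁻¹) ∧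
      (β n)⁻¹ * γ n = l.prod := by
    obtain ⟨v, hv⟩ : ∃ v : B4, v = σ24 * ((σ 0) ^ n * σ13 * ((σ 0) ^ n)⁻¹) := ⟨_, rfl⟩
    refine ⟨((v⁻¹ * (σ 0) ^ n * σ 0) * σ 1 * (v⁻¹ * (σ 0) ^ n * σ 0)⁻¹) ::
      (List.replicate n (σ 0) ++ List.replicate (n + 1) (σ 1)), ?_, ?_, ?_⟩
    · simp only [List.length_cons, List.length_append, List.length_replicate]
      omega
    · intro x hx
      rcases List.mem_cons.1 hx with rfl | hx
      · exact ⟨_, 1, rfl⟩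
      rcases List.mem_append.1 hx with hx | hx
      · exact ⟨1, 0, by simp [List.eq_of_mem_replicate hx]⟩
      · exact ⟨1, 1, by simp [List.eq_of_mem_replicate hx]⟩
    · rw [beta_inv_gamma_eq n v hv, List.prod_cons, List.prod_append, List.prod_replicate,
        List.prod_replicate]
  refine ⟨key, ?_⟩
  obtain ⟨l, -, hl, h⟩ := key
  exact h ▸ list_prod_mem_QP4 hl
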